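/- arXiv:1303.4897 — 2 statements merged into one kernel-verified Lean document; each statement's English description precedes it below -/
import Mathlib

section
/- Suppose G=(V,E) contains an h×h grid as a minor and let S ⊆ V be an interface of the grid minor (one representative vertex from the branch set of every other vertex of the first row of the grid). Then S is well-linked in G, and moreover any matching M on S can be routed integrally in G with congestion 2 (a family of paths joining the matched pairs in which every edge of G is used at most twice). -/
open Finset

/-- Count of occurrences of `e` in a list (classical, no decidability assumptions). -/
noncomputable def ecount {α : Type} (l : List α) (e : α) : ℕ :=
  letI := Classical.decEq α
  l.count e

/-- The number of edges of `G` with exactly one endpoint in `S`, i.e. `|δ(S)|`. -/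
noncomputable def edgeCut {V : Type} (G : SimpleGraph V) (S : Set V) : ℕ :=
  {e ∈ G.edgeSet | ∃ u v, e = s(u, v) ∧ u ∈ S ∧ v ∉ S}.ncard

/-- `X` is (cut-)well-linked in `G`: `|δ(S)| ≥ |S ∩ X|` whenever `|S ∩ X| ≤ |X|/2`. -/
def WellLinked {V : Type} [DecidableEq V] (G : SimpleGraph V) (X : Finset V) : Prop :=
  ∀ S : Finset V, 2 * (S ∩ X).card ≤ X.card → (S ∩ X).card ≤ edgeCut G ↑S

/-- `S` is routable to `T` in `G`: there are `|S|` pairwise edge-disjoint paths from `S`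
to `T` such that every vertex of `S ∪ T` is an endpoint of at most one of the paths
(paths of length 0 are allowed). -/
def Routable {V : Type} (G : SimpleGraph V) (S T : Finset V) : Prop :=
  ∃ (f : V → V) (P : ∀ s ∈ S, G.Walk s (f s)),
    (∀ s ∈ S, f s ∈ T) ∧
    Set.InjOn f ↑S ∧
    (∀ s ∈ S, ∀ s' ∈ S, f s = s' → s = s') ∧
    ∀ e : Sym2 V, (∑ a ∈ S.attach, ecount (P a.1 a.2).edges e) ≤ 1

/-- The maximum number of pairwise edge-disjoint paths from `A` to `B` in `G` (with
every vertex of `A ∪ B` the endpoint of at most one path). -/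
noncomputable def maxEDPaths {V : Type} (G : SimpleGraph V) (A B : Finset V) : ℕ :=
  sSup {r : ℕ | ∃ A' ⊆ A, A'.card = r ∧ Routable G A' B}

/-- The `h × h` grid graph. -/
def gridGraph (h : ℕ) : SimpleGraph (Fin h × Fin h) :=
  SimpleGraph.fromRel (fun a b =>
    (a.1 = b.1 ∧ (a.2 : ℕ) + 1 = (b.2 : ℕ)) ∨ (a.2 = b.2 ∧ (a.1 : ℕ) + 1 = (b.1 : ℕ)))

/-- An `h × h` grid minor of `G`: pairwise disjoint nonempty connected branch sets,
one per grid vertex, with an edge of `G` between the branch sets of adjacent grid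
vertices. -/
structure GridMinor {V : Type} (G : SimpleGraph V) (h : ℕ) where
  branch : Fin h × Fin h → Finset V
  nonempty : ∀ w, (branch w).Nonempty
  pairwise_disjoint : ∀ w w', w ≠ w' → Disjoint (branch w) (branch w')
  connected : ∀ w, (G.induce (↑(branch w) : Set V)).Connected
  adj : ∀ w w', (gridGraph h).Adj w w' →
    ∃ a ∈ branch w, ∃ b ∈ branch w', G.Adj a b

/-- `S` is an interface of the grid minor `gm`: it consists of one representative from
the branch set of every other (even-indexed) vertex of the first row of the grid. -/
def IsInterface {V : Type} [DecidableEq V] {G : SimpleGraph V} {h : ℕ}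
    (gm : GridMinor G h) (S : Finset V) : Prop :=
  ∃ rep : Fin h → V,
    (∀ j : Fin h,
      rep j ∈ gm.branch (⟨0, Nat.lt_of_le_of_lt (Nat.zero_le _) j.isLt⟩, j)) ∧
    S = (Finset.univ.filter (fun j : Fin h => (j : ℕ) % 2 = 0)).image rep

/-- The demand pairs form a matching on the terminals: all `2n` endpoints are distinct. -/
def IsMatchingInstance {V : Type} {n : ℕ} (s t : Fin n → V) : Prop :=
  Function.Injective (fun p : Fin n × Bool => if p.2 then s p.1 else t p.1)

lemma ecount_le_of_nodup {α : Type} {l : List α} (hl : l.Nodup) (e : α) [Decidable (e ∈ l)] :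
    ecount l e ≤ if e ∈ l then 1 else 0 := by
  let _ := Classical.decEq α
  change l.count e ≤ _
  split_ifs with he
  · exact List.nodup_iff_count_le_one.mp hl e
  · exact (List.count_eq_zero_of_not_mem he).le

/-- `a` and `b` are joined by a walk of `G` all of whose vertices lie in `U`. -/
def WalkJoinedIn {V : Type} (G : SimpleGraph V) (U : Set V) (a b : V) : Prop :=
  ∃ p : G.Walk a b, ∀ x ∈ p.support, x ∈ U

namespace WalkJoinedIn

variable {V : Type} {G : SimpleGraph V} {U W : Set V} {a b c : V}

lemma symm (hab : WalkJoinedIn G U a b) : WalkJoinedIn G U b a := by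
  obtain ⟨p, hp⟩ := hab
  exact ⟨p.reverse, by simpa using hp⟩

lemma trans (hab : WalkJoinedIn G U a b) (hbc : WalkJoinedIn G U b c) : WalkJoinedIn G U a c := by
  obtain ⟨p, hp⟩ := hab
  obtain ⟨q, hq⟩ := hbc
  refine ⟨p.append q, fun x hx => ?_⟩
  rcases SimpleGraph.Walk.mem_support_append_iff _ _ |>.mp hx with hx | hx
  exacts [hp x hx, hq x hx]

lemma mono (hUW : U ⊆ W) (hab : WalkJoinedIn G U a b) : WalkJoinedIn G W a b := by
  obtain ⟨p, hp⟩ := hab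
  exact ⟨p, fun x hx => hUW (hp x hx)⟩

lemma of_adj (hab : G.Adj a b) (ha : a ∈ U) (hb : b ∈ U) : WalkJoinedIn G U a b :=
  ⟨hab.toWalk, by simp [ha, hb]⟩

lemma of_induce_preconnected (hU : (G.induce U).Preconnected) (ha : a ∈ U) (hb : b ∈ U) :
    WalkJoinedIn G U a b := by
  obtain ⟨p⟩ := hU ⟨a, ha⟩ ⟨b, hb⟩
  refine ⟨p.map (SimpleGraph.Embedding.induce U).toHom, fun x hx => ?_⟩
  obtain ⟨y, -, rfl⟩ := List.mem_map.mp (SimpleGraph.Walk.support_map _ p ▸ hx)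
  exact y.2

/-- A set joining a vertex of `A` to a vertex outside `A` contains an edge leaving `A`. -/
lemma exists_cut_edge {A : Set V} (hab : WalkJoinedIn G U a b) (ha : a ∈ A) (hb : b ∉ A) :
    ∃ u v, G.Adj u v ∧ u ∈ A ∧ v ∉ A ∧ u ∈ U := by
  obtain ⟨p, hp⟩ := hab
  obtain ⟨d, hd, hd₁, hd₂⟩ := p.exists_boundary_dart A ha hb
  exact ⟨d.fst, d.snd, d.adj, hd₁, hd₂, hp _ (p.dart_fst_mem_support_of_mem_darts hd)⟩

lemma exists_isPath [DecidableEq V] (hab : WalkJoinedIn G U a b) :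
    ∃ p : G.Walk a b, p.IsPath ∧ ∀ x ∈ p.support, x ∈ U := by
  obtain ⟨p, hp⟩ := hab
  exact ⟨p.bypass, p.bypass_isPath, fun x hx => hp x (p.support_bypass_subset_support hx)⟩

end WalkJoinedIn

/-- Disjoint sets each meeting the cut of `A` give that many distinct cut edges. -/
lemma card_le_edgeCut {V ι : Type} [Finite V] (G : SimpleGraph V) (A : Set V) (T : Finset ι)
    (U : ι → Set V) (hU : ∀ i j x, x ∈ U i → x ∈ U j → i = j)
    (hcut : ∀ i ∈ T, ∃ u v, G.Adj u v ∧ u ∈ A ∧ v ∉ A ∧ u ∈ U i) :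
    T.card ≤ edgeCut G A := by
  classical
  rcases T.eq_empty_or_nonempty with rfl | ⟨i₀, hi₀⟩
  · simp
  obtain ⟨x₀, -⟩ := hcut i₀ hi₀
  have : Nonempty V := ⟨x₀⟩
  choose! u v hadj hu hv huU using hcut
  unfold edgeCut
  have hinj : Set.InjOn (fun i => s(u i, v i)) (T : Set ι) := by
    intro i hi j hj hij
    rcases Sym2.eq_iff.mp hij with ⟨h₁, -⟩ | ⟨h₁, -⟩
    · exact hU i j (u i) (huU i hi) (h₁ ▸ huU j hj)
    · exact absurd (h₁ ▸ hu i hi) (hv j hj)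
  rw [← Finset.card_image_of_injOn hinj, ← Set.ncard_coe_finset]
  refine Set.ncard_le_ncard ?_ (Set.toFinite _)
  intro e he
  obtain ⟨i, hi, rfl⟩ := Finset.mem_image.mp (Finset.mem_coe.mp he)
  exact ⟨hadj i hi, u i, v i, rfl, hu i hi, hv i hi⟩

namespace GridMinor

variable {V : Type} {G : SimpleGraph V} {h : ℕ} (gm : GridMinor G h)

/-- The union of the branch sets of the grid vertices in `I`. -/
def region (I : Set (Fin h × Fin h)) : Set V :=
  {x | ∃ w ∈ I, x ∈ gm.branch w}

lemma eq_of_mem_branch {x : V} {w w' : Fin h × Fin h} (hw : x ∈ gm.branch w)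
    (hw' : x ∈ gm.branch w') : w = w' := by
  by_contra hne
  exact Finset.disjoint_left.mp (gm.pairwise_disjoint w w' hne) hw hw'

lemma joinedIn_of_walk {I : Set (Fin h × Fin h)} {w w' : Fin h × Fin h}
    (hww' : WalkJoinedIn (gridGraph h) I w w') {a b : V} (ha : a ∈ gm.branch w)
    (hb : b ∈ gm.branch w') : WalkJoinedIn G (gm.region I) a b := by
  obtain ⟨p, hp⟩ := hww'
  have hbranch : ∀ w ∈ I, ∀ a ∈ gm.branch w, ∀ b ∈ gm.branch w,
      WalkJoinedIn G (gm.region I) a b := fun w hw a ha b hb =>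
    (WalkJoinedIn.of_induce_preconnected (gm.connected w).preconnected ha hb).mono
      fun x hx => ⟨w, hw, hx⟩
  induction p generalizing a with
  | nil => exact hbranch _ (hp _ (by simp)) a ha b hb
  | @cons x y z hxy p ih =>
    obtain ⟨c, hc, d, hd, hcd⟩ := gm.adj x y hxy
    have hx : x ∈ I := hp _ (by simp)
    have hy : y ∈ I := hp _ (by simp)
    exact (hbranch x hx a ha c hc).trans <|
      (WalkJoinedIn.of_adj (U := gm.region I) hcd ⟨x, hx, hc⟩ ⟨y, hy, hd⟩).trans <|
        ih hd hb fun q hq => hp q (by simp [hq])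

end GridMinor

lemma gridGraph_joinedIn_row {h : ℕ} (i j k : Fin h) :
    WalkJoinedIn (gridGraph h) {w | w.1 = i} (i, j) (i, k) := by
  have key : ∀ n (j k : Fin h), (j : ℕ) + n = k →
      WalkJoinedIn (gridGraph h) {w | w.1 = i} (i, j) (i, k) := by
    intro n
    induction n with
    | zero =>
      intro j k hjk
      obtain rfl : j = k := Fin.ext hjk
      exact ⟨.nil, by simp⟩
    | succ n ih =>
      intro j k hjk
      have hk := k.isLt
      refine (ih j ⟨j + n, by omega⟩ rfl).trans (WalkJoinedIn.of_adj ?_ rfl rfl)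
      rw [gridGraph, SimpleGraph.fromRel_adj]
      refine ⟨fun heq => ?_, .inl (.inl ⟨rfl, hjk⟩)⟩
      have := congrArg (fun w : Fin h × Fin h => (w.2 : ℕ)) heq
      simp only at this
      omega
  rcases le_total (j : ℕ) k with hjk | hjk
  · exact key (k - j) j k (by omega)
  · exact (key (j - k) k j (by omega)).symm

lemma gridGraph_joinedIn_col {h : ℕ} (i j k : Fin h) :
    WalkJoinedIn (gridGraph h) {w | w.2 = i} (j, i) (k, i) := by
  have key : ∀ n (j k : Fin h), (j : ℕ) + n = k →
      WalkJoinedIn (gridGraph h) {w | w.2 = i} (j, i) (k, i) := by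
    intro n
    induction n with
    | zero =>
      intro j k hjk
      obtain rfl : j = k := Fin.ext hjk
      exact ⟨.nil, by simp⟩
    | succ n ih =>
      intro j k hjk
      have hk := k.isLt
      refine (ih j ⟨j + n, by omega⟩ rfl).trans (WalkJoinedIn.of_adj ?_ rfl rfl)
      rw [gridGraph, SimpleGraph.fromRel_adj]
      refine ⟨fun heq => ?_, .inl (.inr ⟨rfl, hjk⟩)⟩
      have := congrArg (fun w : Fin h × Fin h => (w.1 : ℕ)) heq
      simp only at this
      omega
  rcases le_total (j : ℕ) k with hjk | hjk
  · exact key (k - j) j k (by omega)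
  · exact (key (j - k) k j (by omega)).symm

namespace GridMinor

variable {V : Type} {G : SimpleGraph V} {h : ℕ} (gm : GridMinor G h)

/-- The union of the branch sets of row `i`. -/
def row (i : Fin h) : Set V := gm.region {w | w.1 = i}

/-- The union of the branch sets of column `j`. -/
def col (j : Fin h) : Set V := gm.region {w | w.2 = j}

lemma joinedIn_row (i : Fin h) {a b : V} (ha : a ∈ gm.row i) (hb : b ∈ gm.row i) :
    WalkJoinedIn G (gm.row i) a b := by
  obtain ⟨⟨_, j⟩, rfl, ha⟩ := ha
  obtain ⟨⟨_, k⟩, rfl, hb⟩ := hb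
  exact gm.joinedIn_of_walk (gridGraph_joinedIn_row _ j k) ha hb

lemma joinedIn_col (j : Fin h) {a b : V} (ha : a ∈ gm.col j) (hb : b ∈ gm.col j) :
    WalkJoinedIn G (gm.col j) a b := by
  obtain ⟨⟨i, _⟩, rfl, ha⟩ := ha
  obtain ⟨⟨k, _⟩, rfl, hb⟩ := hb
  exact gm.joinedIn_of_walk (gridGraph_joinedIn_col _ i k) ha hb

lemma eq_of_mem_row {x : V} {i i' : Fin h} (hi : x ∈ gm.row i) (hi' : x ∈ gm.row i') :
    i = i' := by
  obtain ⟨w, rfl, hw⟩ := hi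
  obtain ⟨w', rfl, hw'⟩ := hi'
  rw [gm.eq_of_mem_branch hw hw']

lemma eq_of_mem_col {x : V} {j j' : Fin h} (hj : x ∈ gm.col j) (hj' : x ∈ gm.col j') :
    j = j' := by
  obtain ⟨w, rfl, hw⟩ := hj
  obtain ⟨w', rfl, hw'⟩ := hj'
  rw [gm.eq_of_mem_branch hw hw']

lemma exists_mem_row_col (i j : Fin h) : ∃ x, x ∈ gm.row i ∧ x ∈ gm.col j := by
  obtain ⟨x, hx⟩ := gm.nonempty (i, j)
  exact ⟨x, ⟨_, rfl, hx⟩, ⟨_, rfl, hx⟩⟩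

/-- A set of terminals in distinct columns of a grid minor is well-linked. -/
lemma wellLinked_of_injOn_col [Finite V] [DecidableEq V] {S : Finset V} (c : V → Fin h)
    (hc : Set.InjOn c S) (hcol : ∀ x ∈ S, x ∈ gm.col (c x)) : WellLinked G S := by
  intro A hA
  have hdisj : ∀ T ⊆ S, (∀ x ∈ T, ∃ u v, G.Adj u v ∧ u ∈ A ∧ v ∉ A ∧ u ∈ gm.col (c x)) →
      T.card ≤ edgeCut G A := by
    intro T hT hcut
    rw [← Finset.card_image_of_injOn (hc.mono (Finset.coe_subset.mpr hT))]
    refine card_le_edgeCut G A _ gm.col (fun _ _ _ => gm.eq_of_mem_col) fun j hj => ?_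
    obtain ⟨x, hx, rfl⟩ := Finset.mem_image.mp hj
    exact hcut x hx
  by_cases hin : ∃ x ∈ S ∩ A, gm.col (c x) ⊆ A
  · by_cases hout : ∃ y ∈ S \ A, ∀ z ∈ gm.col (c y), z ∉ A
    · obtain ⟨x, -, hx⟩ := hin
      obtain ⟨y, -, hy⟩ := hout
      have hrows : (Finset.univ : Finset (Fin h)).card ≤ edgeCut G A := by
        refine card_le_edgeCut G A _ gm.row (fun _ _ _ => gm.eq_of_mem_row) fun i _ => ?_
        obtain ⟨a, har, hac⟩ := gm.exists_mem_row_col i (c x)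
        obtain ⟨b, hbr, hbc⟩ := gm.exists_mem_row_col i (c y)
        exact (gm.joinedIn_row i har hbr).exists_cut_edge (hx hac) (hy b hbc)
      have hS : S.card ≤ (Finset.univ : Finset (Fin h)).card := by
        rw [← Finset.card_image_of_injOn hc]
        exact Finset.card_le_card (Finset.subset_univ _)
      omega
    · push Not at hout
      have := hdisj (S \ A) Finset.sdiff_subset fun y hy => by
        obtain ⟨z, hz, hzA⟩ := hout y hy
        obtain ⟨hyS, hyA⟩ := Finset.mem_sdiff.mp hy
        exact (gm.joinedIn_col _ hz (hcol y hyS)).exists_cut_edge (A := ↑A) hzA hyA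
      have hcard := Finset.card_sdiff_add_card_inter S A
      rw [Finset.inter_comm] at hcard
      omega
  · push Not at hin
    rw [Finset.inter_comm A S]
    refine hdisj (S ∩ A) Finset.inter_subset_left fun x hx => ?_
    obtain ⟨z, hz, hzA⟩ := Set.not_subset.mp (hin x hx)
    obtain ⟨hxS, hxA⟩ := Finset.mem_inter.mp hx
    exact (gm.joinedIn_col _ (hcol x hxS) hz).exists_cut_edge (A := ↑A) hxA hzA

/-- Demand pairs whose terminals lie in pairwise distinct columns of a grid minor can be
routed so that every edge is used at most twice. -/
lemma exists_routing_of_injective_col [DecidableEq V] {n : ℕ} {s t : Fin n → V}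
    (cs ct : Fin n → Fin h) (hs : ∀ d, s d ∈ gm.col (cs d)) (ht : ∀ d, t d ∈ gm.col (ct d))
    (hcs : Function.Injective cs) (hct : Function.Injective ct)
    (hcst : ∀ d d', cs d = ct d' → d = d') :
    ∃ P : ∀ d : Fin n, G.Walk (s d) (t d),
      ∀ e : Sym2 V, (∑ d, ecount (P d).edges e) ≤ 2 := by
  let U : Fin n → Set V := fun d => gm.row (cs d) ∪ (gm.col (cs d) ∪ gm.col (ct d))
  have hjoin : ∀ d, WalkJoinedIn G (U d) (s d) (t d) := by
    intro d
    obtain ⟨a, har, hac⟩ := gm.exists_mem_row_col (cs d) (cs d)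
    obtain ⟨b, hbr, hbc⟩ := gm.exists_mem_row_col (cs d) (ct d)
    refine ((gm.joinedIn_col _ (hs d) hac).mono ?_).trans <|
      ((gm.joinedIn_row _ har hbr).mono ?_).trans <|
        (gm.joinedIn_col _ hbc (ht d)).mono ?_
    · exact fun x hx => .inr (.inl hx)
    · exact fun x hx => .inl hx
    · exact fun x hx => .inr (.inr hx)
  choose P hP hPU using fun d => (hjoin d).exists_isPath
  refine ⟨P, fun e => ?_⟩
  classical
  refine (Finset.sum_le_sum fun d _ => ecount_le_of_nodup (hP d).isTrail.edges_nodup e).trans ?_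
  rw [← Finset.card_filter (fun d => e ∈ (P d).edges)]
  induction e with | _ x y
  have hsub : Finset.univ.filter (fun d => s(x, y) ∈ (P d).edges) ⊆
      Finset.univ.filter (fun d => x ∈ gm.row (cs d)) ∪
        Finset.univ.filter (fun d => x ∈ gm.col (cs d) ∪ gm.col (ct d)) := by
    intro d hd
    rw [← Finset.filter_or]
    simp only [Finset.mem_filter, Finset.mem_univ, true_and] at hd ⊢
    exact hPU d x ((P d).fst_mem_support_of_mem_edges hd)
  refine (Finset.card_le_card hsub).trans <| (Finset.card_union_le _ _).trans ?_
  refine Nat.add_le_add (b := 1) (d := 1) ?_ ?_ <;> rw [Finset.card_le_one] <;>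
    simp only [Finset.mem_filter, Finset.mem_univ, true_and, Set.mem_union]
  · exact fun d hd d' hd' => hcs (gm.eq_of_mem_row hd hd')
  · rintro d (hd | hd) d' (hd' | hd')
    · exact hcs (gm.eq_of_mem_col hd hd')
    · exact hcst _ _ (gm.eq_of_mem_col hd hd')
    · exact (hcst _ _ (gm.eq_of_mem_col hd' hd)).symm
    · exact hct (gm.eq_of_mem_col hd hd')

end GridMinor

/-- **Routing via a grid minor (Lemma `lem:grid-routing`).** Suppose `G` contains an
`h × h` grid as a minor and `S ⊆ V` is an interface of the grid minor. Then `S` is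
well-linked in `G`, and moreover any matching `M` on `S` can be routed integrally in
`G` with congestion `2`: there is a family of paths joining the matched pairs in which
every edge of `G` is used at most twice. -/
theorem grid_interface_well_linked_and_routes
    (V : Type) [Fintype V] [DecidableEq V] (G : SimpleGraph V)
    (h : ℕ) (gm : GridMinor G h) (S : Finset V) (hS : IsInterface gm S) :
    WellLinked G S ∧
    ∀ (n : ℕ) (s t : Fin n → V), IsMatchingInstance s t →
      (∀ d, s d ∈ S ∧ t d ∈ S) →
      ∃ P : ∀ d : Fin n, G.Walk (s d) (t d),
        ∀ e : Sym2 V, (∑ d, ecount (P d).edges e) ≤ 2 := by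
  obtain ⟨rep, hrep, rfl⟩ := hS
  have hcol : ∀ x ∈ (Finset.univ.filter (fun j : Fin h => (j : ℕ) % 2 = 0)).image rep,
      ∃ j, rep j = x ∧ x ∈ gm.col j := by
    intro x hx
    obtain ⟨j, -, rfl⟩ := Finset.mem_image.mp hx
    exact ⟨j, rfl, _, rfl, hrep j⟩
  choose c hc hcc using hcol
  refine ⟨?_, fun n s t hM hst => ?_⟩
  · rcases Nat.eq_zero_or_pos h with rfl | hpos
    · intro A _
      simp
    · refine gm.wellLinked_of_injOn_col (fun x => if hx : x ∈ _ then c x hx else ⟨0, hpos⟩)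
        (fun x hx y hy hxy => ?_) fun x hx => ?_
      · rw [Finset.mem_coe] at hx hy
        simp only [dif_pos hx, dif_pos hy] at hxy
        rw [← hc x hx, ← hc y hy, hxy]
      · simpa only [dif_pos hx] using hcc x hx
  · refine gm.exists_routing_of_injective_col (fun d => c (s d) (hst d).1)
      (fun d => c (t d) (hst d).2) (fun d => hcc _ _) (fun d => hcc _ _)
      (fun d d' hd => ?_) (fun d d' hd => ?_) (fun d d' hd => ?_) <;>
      have hd := congrArg rep hd <;> simp only [hc] at hd
    · exact congrArg Prod.fst (@hM (d, true) (d', true) hd)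
    · exact congrArg Prod.fst (@hM (d, false) (d', false) hd)
    · exact congrArg Prod.fst (@hM (d, true) (d', false) hd)
end

section
/- If H is a well-linked set in a graph G, then for any subsets X, Y ⊆ H with |X| ≤ |Y|, the set X is routable to Y in G: there exist |X| pairwise edge-disjoint paths from X to Y such that every vertex of X ∪ Y is an endpoint of at most one of the paths. -/
open Finset

section ecount

variable {α : Type}

lemma ecount_nil (e : α) : ecount [] e = 0 := by
  simp [ecount]

open Classical in
lemma ecount_cons (x : α) (l : List α) (e : α) :
    ecount (x :: l) e = ecount l e + if e = x then 1 else 0 := by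
  simp only [ecount, List.count_cons, beq_iff_eq, @eq_comm _ x e]

lemma ecount_append (l₁ l₂ : List α) (e : α) :
    ecount (l₁ ++ l₂) e = ecount l₁ e + ecount l₂ e := by
  simp [ecount]

end ecount

section cuts

variable {V : Type}

/-- An edge crosses `S` if exactly one of its endpoints lies in `S`. -/
def Crosses (e : Sym2 V) (S : Set V) : Prop :=
  ∃ u v, e = s(u, v) ∧ u ∈ S ∧ v ∉ S

lemma crosses_mk (u v : V) (S : Set V) :
    Crosses s(u, v) S ↔ (u ∈ S ∧ v ∉ S) ∨ (v ∈ S ∧ u ∉ S) := by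
  constructor
  · rintro ⟨x, y, h, hx, hy⟩
    rcases Sym2.eq_iff.1 h with ⟨rfl, rfl⟩ | ⟨rfl, rfl⟩
    · exact Or.inl ⟨hx, hy⟩
    · exact Or.inr ⟨hx, hy⟩
  · rintro (⟨hu, hv⟩ | ⟨hv, hu⟩)
    · exact ⟨u, v, rfl, hu, hv⟩
    · exact ⟨v, u, Sym2.eq_swap, hv, hu⟩

lemma crosses_compl (e : Sym2 V) (S : Set V) : Crosses e Sᶜ ↔ Crosses e S := by
  induction e with
  | _ u v => simp only [crosses_mk, Set.mem_compl_iff]; tauto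

open Classical in
/-- The number of edges of the finite edge set `E` crossing `S`. -/
noncomputable def cutSize (E : Finset (Sym2 V)) (S : Set V) : ℤ :=
  ∑ e ∈ E, if Crosses e S then 1 else 0

lemma cutSize_inter_add_union_le (E : Finset (Sym2 V)) (S T : Set V) :
    cutSize E (S ∩ T) + cutSize E (S ∪ T) ≤ cutSize E S + cutSize E T := by
  classical
  simp only [cutSize, ← sum_add_distrib]
  refine sum_le_sum fun e _ => ?_
  induction e with
  | _ u v =>
    simp only [crosses_mk, Set.mem_inter_iff, Set.mem_union]
    by_cases h₁ : u ∈ S <;> by_cases h₂ : v ∈ S <;> by_cases h₃ : u ∈ T <;>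
      by_cases h₄ : v ∈ T <;> simp [h₁, h₂, h₃, h₄]

lemma edgeCut_compl (G : SimpleGraph V) (S : Set V) : edgeCut G Sᶜ = edgeCut G S := by
  have h : {e | e ∈ G.edgeSet ∧ Crosses e Sᶜ} = {e | e ∈ G.edgeSet ∧ Crosses e S} := by
    simp only [crosses_compl]
  exact congrArg Set.ncard h

lemma edgeCut_eq_cutSize (G : SimpleGraph V) [Fintype G.edgeSet] (S : Set V) :
    (edgeCut G S : ℤ) = cutSize G.edgeFinset S := by
  classical
  have h : {e | e ∈ G.edgeSet ∧ Crosses e S} =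
      ((G.edgeFinset.filter fun e => Crosses e S : Finset (Sym2 V)) : Set (Sym2 V)) := by
    ext e; simp
  have h' : edgeCut G S = (G.edgeFinset.filter fun e => Crosses e S).card :=
    (congrArg Set.ncard h).trans (Set.ncard_coe_finset _)
  rw [h', cutSize, card_filter]
  push_cast
  rfl

open Classical in
/-- The number of indices `i` with `a i ∈ S`. -/
noncomputable def countIn {ι : Type} [Fintype ι] (a : ι → V) (S : Set V) : ℤ :=
  ∑ i, if a i ∈ S then 1 else 0

lemma countIn_inter_add_union {ι : Type} [Fintype ι] (a : ι → V) (S T : Set V) :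
    countIn a (S ∩ T) + countIn a (S ∪ T) = countIn a S + countIn a T := by
  classical
  simp only [countIn, ← sum_add_distrib]
  refine sum_congr rfl fun i _ => ?_
  by_cases h₁ : a i ∈ S <;> by_cases h₂ : a i ∈ T <;> simp [h₁, h₂]

open Classical in
lemma countIn_option_elim {ι : Type} [Fintype ι] (a : ι → V) (v : V) (S : Set V) :
    countIn (fun o : Option ι => o.elim v a) S = countIn a S + if v ∈ S then 1 else 0 := by
  simp only [countIn, Fintype.sum_option, Option.elim_none, Option.elim_some]
  exact add_comm _ _

lemma countIn_subtype_val (A : Finset V) [DecidableEq V] (S : Finset V) :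
    countIn (fun i : A => (i : V)) (S : Set V) = ((S ∩ A).card : ℤ) := by
  have h : countIn (fun i : A => (i : V)) (S : Set V) = ∑ i ∈ A, if i ∈ S then (1 : ℤ) else 0 := by
    rw [← sum_coe_sort]
    simp only [countIn, mem_coe]
  rw [h, sum_boole, filter_mem_eq_inter, inter_comm]

end cuts

section routing

variable {V : Type}

/-- The sources `a i` can be joined to distinct targets `t (φ i)` by walks of `G` that together
use every edge of `E` at most once and no other edge. -/
def Linked (G : SimpleGraph V) (E : Set (Sym2 V)) {ι κ : Type} [Fintype ι]
    (a : ι → V) (t : κ → V) : Prop :=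
  ∃ (φ : ι → κ) (P : ∀ i, G.Walk (a i) (t (φ i))), Function.Injective φ ∧
    ∀ e, ∑ i, ecount (P i).edges e ≤ 1 ∧ (e ∉ E → ∑ i, ecount (P i).edges e = 0)

lemma Linked.mono {G : SimpleGraph V} {E F : Set (Sym2 V)} (hEF : E ⊆ F) {ι κ : Type} [Fintype ι]
    {a : ι → V} {t : κ → V} (h : Linked G E a t) : Linked G F a t := by
  obtain ⟨φ, P, hφ, hP⟩ := h
  exact ⟨φ, P, hφ, fun e => ⟨(hP e).1, fun he => (hP e).2 fun h => he (hEF h)⟩⟩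

/-- If each vertex is the source of at most as many indices as it is the target of, then the
sources are linked to the targets by trivial walks. -/
lemma linked_empty (G : SimpleGraph V) {ι κ : Type} [Fintype ι] [Fintype κ]
    (a : ι → V) (t : κ → V) (h : ∀ S, countIn a S ≤ countIn t S) : Linked G ∅ a t := by
  classical
  have hemb : ∀ v, Nonempty ({i // a i = v} ↪ {k // t k = v}) := fun v => by
    refine Function.Embedding.nonempty_of_card_le ?_
    have := h {v}
    simp only [countIn, Set.mem_singleton_iff, sum_boole] at this
    rw [Fintype.card_subtype, Fintype.card_subtype]
    exact_mod_cast this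
  let g v := (hemb v).some
  let φ : ι → κ := fun i => (g (a i) ⟨i, rfl⟩).1
  have hφ : ∀ i, t (φ i) = a i := fun i => (g (a i) ⟨i, rfl⟩).2
  refine ⟨φ, fun i => SimpleGraph.Walk.nil.copy rfl (hφ i).symm, fun i j hij => ?_, fun e => ?_⟩
  · have hval : ∀ v (hj : a j = v), φ j = (g v ⟨j, hj⟩).1 := by rintro _ rfl; rfl
    have haij : a j = a i := by rw [← hφ i, hij, hφ j]
    have := (g (a i)).injective (Subtype.ext (hij.trans (hval _ haij)))
    exact congrArg Subtype.val this
  · simp [ecount_nil]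

/-- Adding a source at `v` and a target at `u` amounts to using the edge `uv` once. -/
lemma Linked.of_option {G : SimpleGraph V} {E : Set (Sym2 V)} {ι κ : Type} [Fintype ι]
    {a : ι → V} {t : κ → V} {u v : V} (huv : G.Adj u v) (hE : s(u, v) ∉ E)
    (h : Linked G E (fun o : Option ι => o.elim v a) (fun o : Option κ => o.elim u t)) :
    Linked G (insert s(u, v) E) a t := by
  classical
  obtain ⟨φ, P, hφ, hP⟩ := h
  have key : ∀ i, ∃ (k : κ) (p : G.Walk (a i) (t k)),
      (φ (some i) = some k ∨ φ (some i) = none ∧ φ none = some k) ∧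
      ∀ e, ecount p.edges e ≤ ecount (P (some i)).edges e +
        if φ (some i) = none then ecount (P none).edges e + (if e = s(u, v) then 1 else 0)
        else 0 := by
    intro i
    have aux : ∀ (o o' : Option κ) (p : G.Walk (a i) (o.elim u t)) (q : G.Walk v (o'.elim u t)),
        o ≠ o' → ∃ (k : κ) (r : G.Walk (a i) (t k)),
        (o = some k ∨ o = none ∧ o' = some k) ∧
        ∀ e, ecount r.edges e ≤ ecount p.edges e +
          if o = none then ecount q.edges e + (if e = s(u, v) then 1 else 0) else 0 := by
      intro o o' p q hne
      match o, o', p, q with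
      | some k, _, p, _ => exact ⟨k, p, Or.inl rfl, fun e => Nat.le_add_right _ _⟩
      | none, some k, p, q =>
        change G.Walk (a i) u at p
        change G.Walk v (t k) at q
        refine ⟨k, p.append (SimpleGraph.Walk.cons huv q), Or.inr ⟨rfl, rfl⟩, fun e => ?_⟩
        change _ ≤ ecount p.edges e + if none = none then
          ecount q.edges e + (if e = s(u, v) then 1 else 0) else 0
        rw [SimpleGraph.Walk.edges_append, ecount_append, SimpleGraph.Walk.edges_cons, ecount_cons, if_pos rfl]
        refine le_of_eq ?_
        congr!
      | none, none, _, _ => exact absurd rfl hne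
    exact aux _ _ (P (some i)) (P none) fun h => Option.some_ne_none i (hφ h)
  choose ψ Q hψ hQ using key
  have hψinj : Function.Injective ψ := by
    intro i j hij
    have hi := hψ i
    have hj := hψ j
    rw [← hij] at hj
    have h₁ : ∀ x y, φ x = φ y → x = y := fun x y h => hφ h
    grind
  have hsum : ∀ e, ∑ i, ecount (Q i).edges e ≤
      (∑ o, ecount (P o).edges e) + if e = s(u, v) then 1 else 0 := by
    intro e
    refine (sum_le_sum fun i _ => hQ i e).trans ?_
    have hone : (univ.filter fun i => φ (some i) = none).card ≤ 1 := by
      refine card_le_one.2 fun i hi j hj => ?_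
      simp only [mem_filter, mem_univ, true_and] at hi hj
      exact Option.some_injective _ (hφ (hi.trans hj.symm))
    rw [sum_add_distrib, ← sum_filter, sum_const, Fintype.sum_option, smul_eq_mul]
    have := Nat.mul_le_mul_right
      (ecount (P none).edges e + if e = s(u, v) then 1 else 0) hone
    omega
  refine ⟨ψ, Q, hψinj, fun e => ?_⟩
  have h₁ := hsum e
  obtain ⟨h₂, h₃⟩ := hP e
  by_cases he : e = s(u, v)
  · subst he
    rw [h₃ hE, if_pos rfl] at h₁
    exact ⟨h₁, fun h => absurd (Set.mem_insert _ _) h⟩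
  · rw [if_neg he, add_zero] at h₁
    exact ⟨h₁.trans h₂, fun h => Nat.le_zero.1
      (h₁.trans (h₃ fun h' => h (Set.mem_insert_of_mem _ h')).le)⟩

open Classical in
/-- If deleting the edge `uv` violates the cut condition at some set `S` containing `u` but not
`v`, then sending one unit along the edge from `u` to `v` preserves the cut condition. -/
lemma cut_condition_option {E : Finset (Sym2 V)} {ι κ : Type} [Fintype ι] [Fintype κ]
    {a : ι → V} {t : κ → V} {u v : V} (hE : s(u, v) ∉ E)
    (h : ∀ S, countIn a S ≤ countIn t S + cutSize (insert s(u, v) E) S)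
    {S : Set V} (hu : u ∈ S) (hv : v ∉ S) (hS : countIn t S + cutSize E S < countIn a S)
    (T : Set V) :
    countIn (fun o : Option ι => o.elim v a) T ≤
      countIn (fun o : Option κ => o.elim u t) T + cutSize E T := by
  have h' : ∀ S, countIn a S ≤ countIn t S + cutSize E S +
      if (u ∈ S ∧ v ∉ S) ∨ (v ∈ S ∧ u ∉ S) then 1 else 0 := fun S => by
    have := h S
    rw [cutSize, sum_insert hE] at this
    simp only [crosses_mk] at this
    unfold cutSize
    linarith
  rw [countIn_option_elim, countIn_option_elim]
  have hT := h' T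
  have hi := h' (S ∩ T)
  have hun := h' (S ∪ T)
  have e₁ := countIn_inter_add_union a S T
  have e₂ := countIn_inter_add_union t S T
  have e₃ := cutSize_inter_add_union_le E S T
  simp only [Set.mem_inter_iff, Set.mem_union, hu, hv, true_and, true_or, false_and, false_or,
    not_true, not_false_eq_true, and_false, or_false, and_true] at hi hun
  by_cases h₁ : u ∈ T <;> by_cases h₂ : v ∈ T <;> simp [h₁, h₂] at hT hi hun ⊢ <;> linarith

/-- The integral max-flow min-cut theorem for edge-disjoint walks between families of vertices. -/
theorem linked_of_cut_condition (G : SimpleGraph V) (E : Finset (Sym2 V))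
    (hEG : (E : Set (Sym2 V)) ⊆ G.edgeSet) {ι κ : Type} [Fintype ι] [Fintype κ]
    (a : ι → V) (t : κ → V) (h : ∀ S, countIn a S ≤ countIn t S + cutSize E S) :
    Linked G E a t := by
  classical
  induction E using Finset.induction_on generalizing ι κ with
  | empty =>
    rw [coe_empty]
    exact linked_empty G a t fun S => by simpa [cutSize] using h S
  | insert e E he ih =>
    rw [coe_insert] at hEG ⊢
    have hEG' := (Set.subset_insert _ _).trans hEG
    by_cases hdel : ∀ S, countIn a S ≤ countIn t S + cutSize E S
    · exact (ih hEG' a t hdel).mono (Set.subset_insert _ _)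
    push Not at hdel
    obtain ⟨S, hS⟩ := hdel
    have hc : Crosses e S := by
      by_contra hc
      have := h S
      rw [cutSize, sum_insert he, if_neg hc, zero_add] at this
      exact absurd this (not_le.2 hS)
    obtain ⟨u, v, rfl, hu, hv⟩ := hc
    have huv : G.Adj u v := hEG (Set.mem_insert _ _)
    exact Linked.of_option huv (by simpa using he)
      (ih hEG' _ _ (cut_condition_option he h hu hv hS))

lemma WellLinked.cut_condition [Fintype V] [DecidableEq V] {G : SimpleGraph V} {H : Finset V}
    (hH : WellLinked G H) {A B : Finset V} (hA : A ⊆ H) (hB : B ⊆ H) (hcard : A.card ≤ B.card)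
    (S : Finset V) : (S ∩ A).card ≤ (S ∩ B).card + edgeCut G S := by
  have hsplit : ∀ C : Finset V, (S ∩ C).card + (Sᶜ ∩ C).card = C.card := fun C => by
    rw [inter_comm, inter_comm Sᶜ, ← sdiff_eq_inter_compl, card_inter_add_card_sdiff]
  have hA' := hsplit A
  have hB' := hsplit B
  have hH' := hsplit H
  by_cases hS : 2 * (S ∩ H).card ≤ H.card
  · have h₁ := hH S hS
    have h₂ := card_le_card (inter_subset_inter_left hA : S ∩ A ⊆ S ∩ H)
    omega
  · have h₁ := hH Sᶜ (by omega)
    have h₂ := card_le_card (inter_subset_inter_left hB : Sᶜ ∩ B ⊆ Sᶜ ∩ H)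
    rw [coe_compl, edgeCut_compl] at h₁
    omega

/-- Vertices common to both sides can be routed to themselves by trivial walks. -/
lemma Routable.of_linked_sdiff [DecidableEq V] {G : SimpleGraph V} {E : Set (Sym2 V)}
    {X Y : Finset V}
    (h : Linked G E (fun i : ↥(X \ Y) => (i : V)) (fun k : ↥(Y \ X) => (k : V))) :
    Routable G X Y := by
  obtain ⟨φ, P, hφ, hP⟩ := h
  let W : ∀ s : V, Σ t, G.Walk s t := fun s =>
    if hs : s ∈ X \ Y then ⟨_, P ⟨s, hs⟩⟩ else ⟨s, .nil⟩
  have hpos : ∀ s (hs : s ∈ X \ Y), W s = ⟨_, P ⟨s, hs⟩⟩ := fun s hs => dif_pos hs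
  have hneg : ∀ s, s ∉ X \ Y → W s = ⟨s, .nil⟩ := fun s hs => dif_neg hs
  have hmem : ∀ s ∈ X \ Y, (W s).1 ∈ Y \ X := fun s hs => by
    rw [hpos s hs]; exact (φ _).2
  have hfix : ∀ s ∉ X \ Y, (W s).1 = s := fun s hs => by rw [hneg s hs]
  have hback : ∀ s ∈ X, ∀ s' ∈ X, (W s).1 = s' → s = s' := by
    intro s hs s' hs' hss
    by_cases h : s ∈ X \ Y
    · exact absurd hs' (mem_sdiff.1 (hss ▸ hmem s h)).2
    · exact (hfix s h).symm.trans hss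
  refine ⟨fun s => (W s).1, fun s _ => (W s).2, ?_, ?_, hback, fun e => ?_⟩
  · intro s hs
    by_cases h : s ∈ X \ Y
    · exact (mem_sdiff.1 (hmem s h)).1
    · have : s ∈ Y := by simpa [hs] using h
      simpa only [hfix s h] using this
  · intro s hs s' hs' hss
    by_cases h' : s' ∈ X \ Y
    · by_cases h : s ∈ X \ Y
      · simp only [hpos s h, hpos s' h'] at hss
        exact congrArg Subtype.val (hφ (Subtype.ext hss))
      · exact (hback s' hs' s hs (hss.symm.trans (hfix s h))).symm
    · exact hback s hs s' hs' (hss.trans (hfix s' h'))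
  · have h₁ : ∑ s ∈ X \ Y, ecount (W s).2.edges e = ∑ s ∈ X, ecount (W s).2.edges e := by
      refine sum_subset sdiff_subset fun s _ hs => ?_
      rw [hneg s hs]
      exact ecount_nil e
    rw [sum_attach X fun s => ecount (W s).2.edges e, ← h₁,
      ← sum_coe_sort (X \ Y) fun s => ecount (W s).2.edges e]
    refine le_trans (le_of_eq (sum_congr rfl fun i _ => ?_)) (hP e).1
    rw [hpos i i.2]

end routing

/-- **Routing inside a well-linked set (Prop. `prop:linked`).** If `H` is well-linked
in `G`, then for any `X, Y ⊆ H` with `|X| ≤ |Y|`, the set `X` is routable to `Y` in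
`G`. -/
theorem well_linked_routable
    (V : Type) [Fintype V] [DecidableEq V] (G : SimpleGraph V)
    (H : Finset V) (hH : WellLinked G H)
    (X Y : Finset V) (hX : X ⊆ H) (hY : Y ⊆ H) (hcard : X.card ≤ Y.card) :
    Routable G X Y := by
  classical
  refine Routable.of_linked_sdiff (E := (G.edgeFinset : Set (Sym2 V))) ?_
  refine linked_of_cut_condition G _ (by simp) _ _ fun S => ?_
  have hle : (X \ Y).card ≤ (Y \ X).card := by
    have h₁ := card_sdiff_add_card_inter X Y
    have h₂ := card_sdiff_add_card_inter Y X
    rw [inter_comm Y X] at h₂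
    omega
  have h := hH.cut_condition (sdiff_subset.trans hX) (sdiff_subset.trans hY) hle S.toFinset
  rw [← edgeCut_eq_cutSize, ← Set.coe_toFinset S, countIn_subtype_val, countIn_subtype_val]
  exact_mod_cast h
end
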